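/- Assume c ≠ 0. Let û₋ = (u*, v*, 1) be a zero of F with u* > 0, and let M be the 5×5 real matrix M = [[0,0,0,1,0],[0,0,0,0,1],[−s_u/c, 0, −s_P/c, 0, 0],[−f_u, −f_v, −f_P, −c, 0],[−g_u, −g_v, −g_P, 0, −c]] with all partial derivatives evaluated at û₋ (so s_u(û₋) = 0 and s_P(û₋) = −u*). Then det(M − λI) = (u*/c − λ)·[(λ² + cλ + f_u(û₋))·(λ² + cλ + g_v(û₋)) − f_v(û₋)·g_u(û₋)]. In particular, u*/c is an eigenvalue of M. -/

import Mathlib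

open Real Filter

/-- Kinetics `f(u,v,P)` of the protest model. -/
noncomputable def fkin (α β Γ ω k1 : ℝ) (u v P : ℝ) : ℝ :=
  (1 + P) ^ k1 * (1 / (1 + Real.exp (-β * (v - α)))) * (Γ * u * (1 - u)) - ω * u

/-- Kinetics `g(u,v,P)` of the protest model. -/
noncomputable def gkin (θ k0 k2 : ℝ) (u v P : ℝ) : ℝ :=
  1 - (1 + P) ^ (-k2) * θ * (1 + u) ^ (-k0) * v

/-- Kinetics `s(u,v,P)` of the protest model. -/
def skin (u v P : ℝ) : ℝ := u * (1 - P)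

/-- Partial derivative `∂f/∂u`. -/
noncomputable def f_u (α β Γ ω k1 u v P : ℝ) : ℝ := deriv (fun x => fkin α β Γ ω k1 x v P) u
/-- Partial derivative `∂f/∂v`. -/
noncomputable def f_v (α β Γ ω k1 u v P : ℝ) : ℝ := deriv (fun x => fkin α β Γ ω k1 u x P) v
/-- Partial derivative `∂f/∂P`. -/
noncomputable def f_P (α β Γ ω k1 u v P : ℝ) : ℝ := deriv (fun x => fkin α β Γ ω k1 u v x) P
/-- Partial derivative `∂g/∂u`. -/
noncomputable def g_u (θ k0 k2 u v P : ℝ) : ℝ := deriv (fun x => gkin θ k0 k2 x v P) u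
/-- Partial derivative `∂g/∂v`. -/
noncomputable def g_v (θ k0 k2 u v P : ℝ) : ℝ := deriv (fun x => gkin θ k0 k2 u x P) v
/-- Partial derivative `∂g/∂P`. -/
noncomputable def g_P (θ k0 k2 u v P : ℝ) : ℝ := deriv (fun x => gkin θ k0 k2 u v x) P
/-- Partial derivative `∂s/∂u`. -/
noncomputable def s_u (u v P : ℝ) : ℝ := deriv (fun x => skin x v P) u
/-- Partial derivative `∂s/∂v`. -/
noncomputable def s_v (u v P : ℝ) : ℝ := deriv (fun x => skin u x P) v
/-- Partial derivative `∂s/∂P`. -/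
noncomputable def s_P (u v P : ℝ) : ℝ := deriv (fun x => skin u v x) P

theorem det_aux (a b d e p q c x l : ℝ) :
    Matrix.det (!![0, 0, 0, 1, 0;
         0, 0, 0, 0, 1;
         0, 0, x, 0, 0;
         -a, -b, -p, -c, 0;
         -d, -e, -q, 0, -c] - l • (1 : Matrix (Fin 5) (Fin 5) ℝ)) =
      (x - l) * ((l ^ 2 + c * l + a) * (l ^ 2 + c * l + e) - b * d) := by
  have h : (!![0, 0, 0, 1, 0;
         0, 0, 0, 0, 1;
         0, 0, x, 0, 0;
         -a, -b, -p, -c, 0;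
         -d, -e, -q, 0, -c] - l • (1 : Matrix (Fin 5) (Fin 5) ℝ)) =
      !![-l, 0, 0, 1, 0;
         0, -l, 0, 0, 1;
         0, 0, x - l, 0, 0;
         -a, -b, -p, -c - l, 0;
         -d, -e, -q, 0, -c - l] := by
    ext i j
    fin_cases i <;> fin_cases j <;> simp [Matrix.one_apply]
  rw [h]
  simp [Matrix.det_succ_row_zero, Fin.sum_univ_succ, Fin.succAbove]
  ring

/-- with `c ≠ 0`, at a zero `û₋ = (u*, v*, 1)` of `F` with `u* > 0`, the
linearization matrix `M` of the first-order traveling-wave system satisfies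
`det(M − λI) = (u*/c − λ)·[(λ² + cλ + f_u(û₋))(λ² + cλ + g_v(û₋)) − f_v(û₋)·g_u(û₋)]`;
in particular `u*/c` is an eigenvalue of `M`. -/
theorem stmt16 (α β Γ ω θ k0 k1 k2 c : ℝ) (hc : c ≠ 0)
    (ustar vstar : ℝ)
    (hzero : fkin α β Γ ω k1 ustar vstar 1 = 0 ∧ gkin θ k0 k2 ustar vstar 1 = 0 ∧
      skin ustar vstar 1 = 0)
    (hu : 0 < ustar)
    (M : Matrix (Fin 5) (Fin 5) ℝ)
    (hM : M =
      !![0, 0, 0, 1, 0;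
         0, 0, 0, 0, 1;
         -(s_u ustar vstar 1) / c, 0, -(s_P ustar vstar 1) / c, 0, 0;
         -(f_u α β Γ ω k1 ustar vstar 1), -(f_v α β Γ ω k1 ustar vstar 1),
           -(f_P α β Γ ω k1 ustar vstar 1), -c, 0;
         -(g_u θ k0 k2 ustar vstar 1), -(g_v θ k0 k2 ustar vstar 1),
           -(g_P θ k0 k2 ustar vstar 1), 0, -c]) :
    (∀ lam : ℝ,
      Matrix.det (M - lam • (1 : Matrix (Fin 5) (Fin 5) ℝ)) =
        (ustar / c - lam) *
          ((lam ^ 2 + c * lam + f_u α β Γ ω k1 ustar vstar 1) *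
              (lam ^ 2 + c * lam + g_v θ k0 k2 ustar vstar 1) -
            f_v α β Γ ω k1 ustar vstar 1 * g_u θ k0 k2 ustar vstar 1)) ∧
    Matrix.det (M - (ustar / c) • (1 : Matrix (Fin 5) (Fin 5) ℝ)) = 0 := by
  have hsu : s_u ustar vstar 1 = 0 := by
    simp [s_u, skin]
  have hsP : s_P ustar vstar 1 = -ustar := by
    have h : HasDerivAt (fun x : ℝ => ustar * (1 - x)) (ustar * (-1)) 1 :=
      ((hasDerivAt_id (1 : ℝ)).const_sub 1).const_mul ustar
    have h2 := h.deriv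
    simp only [s_P, skin]
    rw [h2]; ring
  have key : ∀ lam : ℝ,
      Matrix.det (M - lam • (1 : Matrix (Fin 5) (Fin 5) ℝ)) =
        (ustar / c - lam) *
          ((lam ^ 2 + c * lam + f_u α β Γ ω k1 ustar vstar 1) *
              (lam ^ 2 + c * lam + g_v θ k0 k2 ustar vstar 1) -
            f_v α β Γ ω k1 ustar vstar 1 * g_u θ k0 k2 ustar vstar 1) := by
    intro lam
    rw [hM, hsu, hsP, neg_neg, neg_zero, zero_div]
    exact det_aux _ _ _ _ _ _ _ _ _
  refine ⟨key, ?_⟩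
  rw [key, sub_self, zero_mul]
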